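/- arXiv:2011.05931 — 3 statements merged into one kernel-verified Lean document; each statement's English description precedes it below -/
import Mathlib

section
/- Let n ≥ 1, d > 0 and λ, μ, λ', μ' ∈ [0,∞)^n. Let A := {i ∈ {0, …, n−1} : λ_i ≥ μ_i}. Suppose that λ'_i ≥ λ_i and μ'_i ≤ μ_i for every i ∈ A, and λ'_i ≤ λ_i and μ'_i ≥ μ_i for every i ∉ A. Then P_e(λ', μ') ≤ P_e(λ, μ). -/
open scoped BigOperators

/-- Poisson probability mass at `k` for mean `a`. -/
noncomputable def poissonPdf (a : ℝ) (k : ℕ) : ℝ :=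
  Real.exp (-a) * a ^ k / (Nat.factorial k : ℝ)

/-- Joint pmf of independent Poisson coordinates with mean vector `m`. -/
noncomputable def prodPdf {n : ℕ} (m : Fin n → ℝ) (y : Fin n → ℕ) : ℝ :=
  ∏ i, poissonPdf (m i) (y i)

/-- Average error probability of a decoder `g` for the binary hypothesis test between
independent Poisson observations with mean vectors `lam + d` (hypothesis 1) and
`mu + d` (hypothesis 2); `g y = true` means "decide hypothesis 1". -/
noncomputable def errProb {n : ℕ} (d : ℝ) (lam mu : Fin n → ℝ)
    (g : (Fin n → ℕ) → Bool) : ℝ :=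
  (1/2) * (∑' y : Fin n → ℕ, if g y = false then prodPdf (fun i => lam i + d) y else 0)
  + (1/2) * (∑' y : Fin n → ℕ, if g y = true then prodPdf (fun i => mu i + d) y else 0)

/-- Minimal (maximum-likelihood) average error probability. -/
noncomputable def Pe {n : ℕ} (d : ℝ) (lam mu : Fin n → ℝ) : ℝ :=
  ⨅ g : (Fin n → ℕ) → Bool, errProb d lam mu g

/-- Convolution of a codeword `x` of length `N` with channel coefficients `p` of length `K`,
giving the mean vector of length `N + K - 1`. -/
noncomputable def cconv {N K : ℕ} (x : Fin N → ℝ) (p : Fin K → ℝ) :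
    Fin (N + K - 1) → ℝ :=
  fun i => ∑ j : Fin K,
    p j * (if h : (j : ℕ) ≤ (i : ℕ) ∧ (i : ℕ) - (j : ℕ) < N
      then x ⟨(i : ℕ) - (j : ℕ), h.2⟩ else 0)

/-- Sum of the `k` largest entries of `v`. -/
noncomputable def topSum {m : ℕ} (v : Fin m → ℝ) (k : ℕ) : ℝ :=
  ⨆ s ∈ {s : Finset (Fin m) | s.card = k}, ∑ i ∈ s, v i

/-- Weak submajorization (from below): every top-`k` sum of `u` is at most that of `v`. -/
def weakSubmaj {m : ℕ} (u v : Fin m → ℝ) : Prop :=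
  ∀ k, 1 ≤ k → k ≤ m → topSum u k ≤ topSum v k

lemma poissonPdf_nonneg {a : ℝ} (ha : 0 ≤ a) (k : ℕ) : 0 ≤ poissonPdf a k := by
  unfold poissonPdf
  positivity

lemma hasSum_pow_div_factorial (a : ℝ) :
    HasSum (fun k : ℕ => a ^ k / (Nat.factorial k : ℝ)) (Real.exp a) := by
  rw [Real.exp_eq_exp_ℝ]
  exact NormedSpace.expSeries_div_hasSum_exp a

lemma hasSum_poissonPdf (a : ℝ) : HasSum (poissonPdf a) 1 := by
  have h := (hasSum_pow_div_factorial a).mul_left (Real.exp (-a))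
  rw [← Real.exp_add, neg_add_cancel, Real.exp_zero] at h
  exact h.congr_fun fun k => by simp only [poissonPdf]; ring

/-- Fubini for a product of finitely many nonnegative series. -/
lemma hasSum_prod_pi {n : ℕ} {f : Fin n → ℕ → ℝ} {s : Fin n → ℝ}
    (hf : ∀ i k, 0 ≤ f i k) (hs : ∀ i, HasSum (f i) (s i)) :
    HasSum (fun y : Fin n → ℕ => ∏ i, f i (y i)) (∏ i, s i) := by
  induction n with
  | zero => simp
  | succ n ih =>
    have ih := ih (fun i k => hf (Fin.succ i) k) fun i => hs (Fin.succ i)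
    have hm : Summable fun x : ℕ × (Fin n → ℕ) => f 0 x.1 * ∏ i, f (Fin.succ i) (x.2 i) :=
      Summable.mul_of_nonneg (f := f 0) (g := fun y : Fin n → ℕ => ∏ i, f (Fin.succ i) (y i))
        (hs 0).summable ih.summable (hf 0) fun y => Finset.prod_nonneg fun i _ => hf _ _
    have h := HasSum.mul (hs 0) ih hm
    rw [Fin.prod_univ_succ, ← (Fin.consEquiv fun _ => ℕ).hasSum_iff]
    refine h.congr_fun fun x => ?_
    simp [Fin.prod_univ_succ, Fin.consEquiv]

lemma prodPdf_nonneg {n : ℕ} {m : Fin n → ℝ} (hm : ∀ i, 0 ≤ m i) (y : Fin n → ℕ) :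
    0 ≤ prodPdf m y :=
  Finset.prod_nonneg fun i _ => poissonPdf_nonneg (hm i) _

lemma summable_prodPdf {n : ℕ} {m : Fin n → ℝ} (hm : ∀ i, 0 ≤ m i) :
    Summable (prodPdf m) :=
  (hasSum_prod_pi (fun i => poissonPdf_nonneg (hm i))
    fun i => hasSum_poissonPdf (m i)).summable

/-- Data processing for the overlap `∑ min (P, M)`: it increases under a stochastic kernel. -/
lemma tsum_min_le_of_kernel {α β : Type*} {P M : α → ℝ} {P' M' : β → ℝ} {K : α → β → ℝ}
    (hP : ∀ a, 0 ≤ P a) (hM : ∀ a, 0 ≤ M a) (sP : Summable P)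
    (hP' : ∀ b, 0 ≤ P' b) (hM' : ∀ b, 0 ≤ M' b) (sP' : Summable P')
    (hK : ∀ a b, 0 ≤ K a b) (hK1 : ∀ a, HasSum (K a) 1)
    (hKP : ∀ b, HasSum (fun a => P a * K a b) (P' b))
    (hKM : ∀ b, HasSum (fun a => M a * K a b) (M' b)) :
    ∑' a, min (P a) (M a) ≤ ∑' b, min (P' b) (M' b) := by
  have hf : ∀ a, 0 ≤ min (P a) (M a) := fun a => le_min (hP a) (hM a)
  have sf : Summable fun a => min (P a) (M a) :=
    Summable.of_nonneg_of_le hf (fun a => min_le_left _ _) sP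
  have sf' : Summable fun b => min (P' b) (M' b) :=
    Summable.of_nonneg_of_le (fun b => le_min (hP' b) (hM' b)) (fun b => min_le_left _ _) sP'
  have rows : ∀ a, HasSum (fun b => min (P a) (M a) * K a b) (min (P a) (M a)) := fun a => by
    simpa using (hK1 a).mul_left (min (P a) (M a))
  have joint : Summable fun x : α × β => min (P x.1) (M x.1) * K x.1 x.2 := by
    rw [summable_prod_of_nonneg fun x => mul_nonneg (hf _) (hK _ _)]
    exact ⟨fun a => (rows a).summable, by simpa only [(rows _).tsum_eq] using sf⟩
  have swap : ∑' b, ∑' a, min (P a) (M a) * K a b = ∑' a, min (P a) (M a) := by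
    rw [Summable.tsum_comm (f := fun a b => min (P a) (M a) * K a b) joint]
    exact tsum_congr fun a => (rows a).tsum_eq
  have cols : ∀ b, Summable fun a => min (P a) (M a) * K a b := fun b =>
    joint.prod_symm.prod_factor b
  rw [← swap]
  refine Summable.tsum_le_tsum (fun b => le_min ?_ ?_) joint.prod_symm.prod sf'
  · exact hasSum_le (fun a => mul_le_mul_of_nonneg_right (min_le_left _ _) (hK a b))
      (cols b).hasSum (hKP b)
  · exact hasSum_le (fun a => mul_le_mul_of_nonneg_right (min_le_right _ _) (hK a b))
      (cols b).hasSum (hKM b)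

lemma errProb_eq_tsum {n : ℕ} {d : ℝ} {lam mu : Fin n → ℝ}
    (hl : ∀ i, 0 ≤ lam i + d) (hm : ∀ i, 0 ≤ mu i + d) (g : (Fin n → ℕ) → Bool) :
    Summable (fun y => if g y = false then prodPdf (fun i => lam i + d) y
      else prodPdf (fun i => mu i + d) y) ∧
    errProb d lam mu g = (1/2) * ∑' y, if g y = false then prodPdf (fun i => lam i + d) y
      else prodPdf (fun i => mu i + d) y := by
  have s1 : Summable fun y => if g y = false then prodPdf (fun i => lam i + d) y else 0 :=
    (summable_prodPdf hl).of_nonneg_of_le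
      (fun y => by split_ifs <;> simp [prodPdf_nonneg hl])
      (fun y => by split_ifs <;> simp [prodPdf_nonneg hl])
  have s2 : Summable fun y => if g y = true then prodPdf (fun i => mu i + d) y else 0 :=
    (summable_prodPdf hm).of_nonneg_of_le
      (fun y => by split_ifs <;> simp [prodPdf_nonneg hm])
      (fun y => by split_ifs <;> simp [prodPdf_nonneg hm])
  have e : (fun y => if g y = false then prodPdf (fun i => lam i + d) y
      else prodPdf (fun i => mu i + d) y) =
      fun y => (if g y = false then prodPdf (fun i => lam i + d) y else 0) +
        if g y = true then prodPdf (fun i => mu i + d) y else 0 := by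
    funext y
    cases g y <;> simp
  rw [errProb, e, s1.tsum_add s2, mul_add]
  exact ⟨s1.add s2, rfl⟩

lemma Pe_eq_tsum_min {n : ℕ} {d : ℝ} {lam mu : Fin n → ℝ}
    (hl : ∀ i, 0 ≤ lam i + d) (hm : ∀ i, 0 ≤ mu i + d) :
    Pe d lam mu = (1/2) * ∑' y : Fin n → ℕ,
      min (prodPdf (fun i => lam i + d) y) (prodPdf (fun i => mu i + d) y) := by
  have sm : Summable fun y : Fin n → ℕ =>
      min (prodPdf (fun i => lam i + d) y) (prodPdf (fun i => mu i + d) y) :=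
    (summable_prodPdf hl).of_nonneg_of_le
      (fun y => le_min (prodPdf_nonneg hl y) (prodPdf_nonneg hm y)) fun y => min_le_left _ _
  have lower : ∀ g, (1/2) * ∑' y : Fin n → ℕ,
      min (prodPdf (fun i => lam i + d) y) (prodPdf (fun i => mu i + d) y) ≤
      errProb d lam mu g := fun g => by
    obtain ⟨s, e⟩ := errProb_eq_tsum hl hm g
    rw [e]
    refine mul_le_mul_of_nonneg_left (sm.tsum_le_tsum (fun y => ?_) s) (by norm_num)
    split_ifs
    exacts [min_le_left _ _, min_le_right _ _]
  refine le_antisymm ?_ (le_ciInf lower)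
  classical
  refine (ciInf_le ⟨_, Set.forall_mem_range.2 lower⟩ fun y =>
    decide (prodPdf (fun i => mu i + d) y ≤ prodPdf (fun i => lam i + d) y)).trans_eq ?_
  rw [(errProb_eq_tsum hl hm _).2]
  congr 1
  refine tsum_congr fun y => ?_
  simp only [decide_eq_false_iff_not, ite_not]
  split_ifs with h
  · exact (min_eq_right h).symm
  · exact (min_eq_left (not_le.1 h).le).symm

/-- Passing each coordinate through a stochastic kernel cannot decrease the error. -/
lemma Pe_le_of_kernel {n : ℕ} {x y x' y' : Fin n → ℝ} {K : Fin n → ℕ → ℕ → ℝ}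
    (hx : ∀ i, 0 ≤ x i) (hy : ∀ i, 0 ≤ y i) (hx' : ∀ i, 0 ≤ x' i) (hy' : ∀ i, 0 ≤ y' i)
    (hK : ∀ i k j, 0 ≤ K i k j) (hK1 : ∀ i k, HasSum (K i k) 1)
    (hKx : ∀ i j, HasSum (fun k => poissonPdf (x i) k * K i k j) (poissonPdf (x' i) j))
    (hKy : ∀ i j, HasSum (fun k => poissonPdf (y i) k * K i k j) (poissonPdf (y' i) j)) :
    Pe 0 x y ≤ Pe 0 x' y' := by
  rw [Pe_eq_tsum_min (by simpa using hx) (by simpa using hy),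
    Pe_eq_tsum_min (by simpa using hx') (by simpa using hy')]
  simp only [add_zero]
  refine mul_le_mul_of_nonneg_left ?_ (by norm_num)
  refine tsum_min_le_of_kernel (K := fun u v => ∏ i, K i (u i) (v i))
    (prodPdf_nonneg hx) (prodPdf_nonneg hy) (summable_prodPdf hx)
    (prodPdf_nonneg hx') (prodPdf_nonneg hy') (summable_prodPdf hx')
    (fun u v => Finset.prod_nonneg fun i _ => hK i _ _) (fun u => ?_) (fun v => ?_) (fun v => ?_)
  · simpa using hasSum_prod_pi (fun i => hK i (u i)) fun i => hK1 i (u i)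
  · simpa only [prodPdf, Finset.prod_mul_distrib] using hasSum_prod_pi
      (fun i k => mul_nonneg (poissonPdf_nonneg (hx i) k) (hK i k (v i))) fun i => hKx i (v i)
  · simpa only [prodPdf, Finset.prod_mul_distrib] using hasSum_prod_pi
      (fun i k => mul_nonneg (poissonPdf_nonneg (hy i) k) (hK i k (v i))) fun i => hKy i (v i)

/-- Binomial thinning kernel: each of `k` points is kept with probability `p`. -/
noncomputable def thinKernel (p : ℝ) (k j : ℕ) : ℝ :=
  p ^ j * (1 - p) ^ (k - j) * (k.choose j : ℝ)

lemma hasSum_thinKernel (p : ℝ) (k : ℕ) : HasSum (thinKernel p k) 1 := by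
  have h := hasSum_sum_of_ne_finset_zero (L := .unconditional ℕ) (f := thinKernel p k)
    (s := Finset.range (k + 1))
    fun j hj => by
      simp [thinKernel, Nat.choose_eq_zero_of_lt (by simpa using hj : k < j)]
  simp only [thinKernel] at h
  rwa [← add_pow, add_sub_cancel, one_pow] at h

lemma hasSum_poissonPdf_mul_thinKernel (p x : ℝ) (j : ℕ) :
    HasSum (fun k => poissonPdf x k * thinKernel p k j) (poissonPdf (p * x) j) := by
  rw [← hasSum_nat_add_iff' j, Finset.sum_eq_zero, sub_zero]
  · have h := (hasSum_pow_div_factorial (x * (1 - p))).mul_left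
      (Real.exp (-x) * (p * x) ^ j / (Nat.factorial j : ℝ))
    convert! h using 1
    · funext m
      have hc : ((m + j).choose j : ℝ) * (Nat.factorial m * Nat.factorial j : ℝ) =
          (Nat.factorial (m + j) : ℝ) := by
        have := Nat.choose_mul_factorial_mul_factorial (Nat.le_add_left j m)
        rw [Nat.add_sub_cancel, mul_assoc, mul_comm j.factorial] at this
        exact_mod_cast this
      have h0 : ((m + j).choose j : ℝ) ≠ 0 :=
        Nat.cast_ne_zero.2 (Nat.choose_pos (Nat.le_add_left j m)).ne'
      simp only [poissonPdf, thinKernel, Nat.add_sub_cancel, ← hc, mul_pow]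
      have h1 : (Nat.factorial m : ℝ) ≠ 0 := Nat.cast_ne_zero.2 m.factorial_ne_zero
      have h2 : (Nat.factorial j : ℝ) ≠ 0 := Nat.cast_ne_zero.2 j.factorial_ne_zero
      field_simp
      ring
    · have : Real.exp (-(p * x)) = Real.exp (-x) * Real.exp (x * (1 - p)) := by
        rw [← Real.exp_add]
        congr 1
        ring
      rw [poissonPdf, this]
      ring
  · intro k hk
    simp [thinKernel, Nat.choose_eq_zero_of_lt (Finset.mem_range.1 hk)]

/-- Kernel adding an independent Poisson variable of mean `c`. -/
noncomputable def addKernel (c : ℝ) (k j : ℕ) : ℝ :=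
  if k ≤ j then poissonPdf c (j - k) else 0

lemma hasSum_addKernel (c : ℝ) (k : ℕ) : HasSum (addKernel c k) 1 := by
  rw [← hasSum_nat_add_iff' k, Finset.sum_eq_zero, sub_zero]
  · simpa [addKernel] using hasSum_poissonPdf c
  · intro j hj
    simp [addKernel, not_le.2 (Finset.mem_range.1 hj)]

lemma hasSum_poissonPdf_mul_addKernel (c x : ℝ) (j : ℕ) :
    HasSum (fun k => poissonPdf x k * addKernel c k j) (poissonPdf (x + c) j) := by
  have h := hasSum_sum_of_ne_finset_zero (L := .unconditional ℕ)
    (f := fun k => poissonPdf x k * addKernel c k j)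
    (s := Finset.range (j + 1)) fun k hk => by
      simp [addKernel, not_le.2 (by simpa using hk : j < k)]
  convert! h using 1
  rw [poissonPdf, add_pow, Finset.mul_sum, Finset.sum_div]
  refine Finset.sum_congr rfl fun k hk => ?_
  have hk : k ≤ j := Nat.lt_succ_iff.1 (Finset.mem_range.1 hk)
  have hc : (j.choose k : ℝ) * Nat.factorial k * Nat.factorial (j - k) = Nat.factorial j := by
    exact_mod_cast Nat.choose_mul_factorial_mul_factorial hk
  have h0 : (j.choose k : ℝ) ≠ 0 := Nat.cast_ne_zero.2 (Nat.choose_pos hk).ne'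
  have h1 : (Nat.factorial k : ℝ) ≠ 0 := Nat.cast_ne_zero.2 k.factorial_ne_zero
  have h2 : (Nat.factorial (j - k) : ℝ) ≠ 0 := Nat.cast_ne_zero.2 (j - k).factorial_ne_zero
  rw [addKernel, if_pos hk, poissonPdf, poissonPdf, neg_add, Real.exp_add, ← hc]
  field_simp

lemma Pe_le_Pe_mul_add {n : ℕ} {x y p c : Fin n → ℝ}
    (hx : ∀ i, 0 ≤ x i) (hy : ∀ i, 0 ≤ y i)
    (hp : ∀ i, 0 ≤ p i) (hp1 : ∀ i, p i ≤ 1) (hc : ∀ i, 0 ≤ c i) :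
    Pe 0 x y ≤ Pe 0 (fun i => p i * x i + c i) (fun i => p i * y i + c i) := by
  have hpx : ∀ i, 0 ≤ p i * x i := fun i => mul_nonneg (hp i) (hx i)
  have hpy : ∀ i, 0 ≤ p i * y i := fun i => mul_nonneg (hp i) (hy i)
  calc Pe 0 x y ≤ Pe 0 (fun i => p i * x i) (fun i => p i * y i) :=
        Pe_le_of_kernel (K := fun i => thinKernel (p i)) hx hy hpx hpy
          (fun i k j => mul_nonneg (mul_nonneg (pow_nonneg (hp i) _)
            (pow_nonneg (sub_nonneg.2 (hp1 i)) _)) (Nat.cast_nonneg _))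
          (fun i => hasSum_thinKernel (p i))
          (fun i => hasSum_poissonPdf_mul_thinKernel (p i) (x i))
          (fun i => hasSum_poissonPdf_mul_thinKernel (p i) (y i))
    _ ≤ _ :=
        Pe_le_of_kernel (K := fun i => addKernel (c i)) hpx hpy
          (fun i => add_nonneg (hpx i) (hc i)) (fun i => add_nonneg (hpy i) (hc i))
          (fun i k j => by
            simp only [addKernel]
            split_ifs
            exacts [poissonPdf_nonneg (hc i) _, le_rfl])
          (fun i => hasSum_addKernel (c i))
          (fun i => hasSum_poissonPdf_mul_addKernel (c i) (p i * x i))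
          (fun i => hasSum_poissonPdf_mul_addKernel (c i) (p i * y i))

lemma Pe_eq_Pe_zero {n : ℕ} (d : ℝ) (lam mu : Fin n → ℝ) :
    Pe d lam mu = Pe 0 (fun i => lam i + d) (fun i => mu i + d) := by
  simp only [Pe, errProb, add_zero]

/-- A smaller interval `[b, a]` is the image of `[b', a']` under an affine contraction that can
be realized by thinning and adding noise. -/
lemma exists_thin_add {a b a' b' : ℝ} (hb' : 0 ≤ b') (hba : b ≤ a) (ha : a ≤ a')
    (hb : b' ≤ b) :
    ∃ p c : ℝ, 0 ≤ p ∧ p ≤ 1 ∧ 0 ≤ c ∧ p * a' + c = a ∧ p * b' + c = b := by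
  rcases (hb.trans (hba.trans ha)).eq_or_lt with h | h
  · exact ⟨1, 0, by norm_num, le_rfl, le_rfl, by linarith, by linarith⟩
  · have hpos : 0 < a' - b' := sub_pos.2 h
    have hp1 : (a - b) / (a' - b') ≤ 1 := (div_le_one hpos).2 (by linarith)
    have hp : (a - b) / (a' - b') * (a' - b') = a - b := div_mul_cancel₀ _ hpos.ne'
    refine ⟨(a - b) / (a' - b'), b - (a - b) / (a' - b') * b',
      div_nonneg (by linarith) hpos.le, hp1, ?_, by linarith, by ring⟩
    have := mul_le_mul_of_nonneg_right hp1 hb'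
    linarith

/-- Monotonicity of the ML error probability: on indices where `λ_i ≥ μ_i`, increasing
`λ_i` and decreasing `μ_i` does not increase the error, and on the remaining indices
decreasing `λ_i` and increasing `μ_i` does not increase the error. -/
theorem stmt7 (n : ℕ) (hn : 1 ≤ n) (d : ℝ) (hd : 0 < d)
    (lam mu lam' mu' : Fin n → ℝ)
    (hlam : ∀ i, 0 ≤ lam i) (hmu : ∀ i, 0 ≤ mu i)
    (hlam' : ∀ i, 0 ≤ lam' i) (hmu' : ∀ i, 0 ≤ mu' i)
    (h1 : ∀ i, mu i ≤ lam i → lam i ≤ lam' i ∧ mu' i ≤ mu i)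
    (h2 : ∀ i, ¬ mu i ≤ lam i → lam' i ≤ lam i ∧ mu i ≤ mu' i) :
    Pe d lam' mu' ≤ Pe d lam mu := by
  have key : ∀ i, ∃ p c : ℝ, 0 ≤ p ∧ p ≤ 1 ∧ 0 ≤ c ∧
      p * (lam' i + d) + c = lam i + d ∧ p * (mu' i + d) + c = mu i + d := fun i => by
    by_cases h : mu i ≤ lam i
    · obtain ⟨ha, hb⟩ := h1 i h
      exact exists_thin_add (add_nonneg (hmu' i) hd.le) (by linarith) (by linarith) (by linarith)
    · obtain ⟨ha, hb⟩ := h2 i h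
      obtain ⟨p, c, hp, hp1, hc, e1, e2⟩ := exists_thin_add (a := mu i + d) (b := lam i + d)
        (a' := mu' i + d) (add_nonneg (hlam' i) hd.le) (by linarith) (by linarith) (by linarith)
      exact ⟨p, c, hp, hp1, hc, e2, e1⟩
  choose p c hp hp1 hc e1 e2 using key
  have h := Pe_le_Pe_mul_add (fun i => add_nonneg (hlam' i) hd.le)
    (fun i => add_nonneg (hmu' i) hd.le) hp hp1 hc
  simp only [e1, e2] at h
  rwa [Pe_eq_Pe_zero d lam' mu', Pe_eq_Pe_zero d lam mu]
end

section
/- Let n ≥ 1, d > 0 and λ, μ ∈ [0,∞)^n, and set a_i := log((λ_i + d)/(μ_i + d)) for each i. Let j ≠ k be indices with a_j ≥ a_k, let 0 ≤ ε ≤ λ_k, and define λ' ∈ [0,∞)^n by λ'_j = λ_j + ε, λ'_k = λ_k − ε, and λ'_i = λ_i for i ∉ {j, k}. Then P_e(λ', μ) ≤ P_e(λ, μ). -/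
open scoped BigOperators

/-- The Poisson distributions form a convolution semigroup. -/
lemma poissonPdf_add (a b : ℝ) (k : ℕ) :
    poissonPdf (a + b) k =
      ∑ e ∈ Finset.range (k + 1), poissonPdf a (k - e) * poissonPdf b e := by
  unfold poissonPdf
  rw [add_comm a b, add_pow, Finset.mul_sum, Finset.sum_div]
  refine Finset.sum_congr rfl fun e he => ?_
  have hek : e ≤ k := Nat.lt_succ_iff.mp (Finset.mem_range.mp he)
  rw [neg_add, Real.exp_add, Nat.cast_choose ℝ hek]
  field_simp

lemma prodPdf_eq_mul_erase {n : ℕ} (m : Fin n → ℝ) (y : Fin n → ℕ) (j : Fin n) :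
    prodPdf m y = poissonPdf (m j) (y j) * ∏ i ∈ Finset.univ.erase j, poissonPdf (m i) (y i) :=
  (Finset.mul_prod_erase _ _ (Finset.mem_univ j)).symm

lemma prodPdf_update_add {n : ℕ} (m : Fin n → ℝ) (j : Fin n) (ε : ℝ) (y : Fin n → ℕ) :
    prodPdf (Function.update m j (m j + ε)) y =
      ∑ e ∈ Finset.range (y j + 1),
        prodPdf m (Function.update y j (y j - e)) * poissonPdf ε e := by
  rw [prodPdf_eq_mul_erase _ _ j, Function.update_self, poissonPdf_add, Finset.sum_mul]
  refine Finset.sum_congr rfl fun e _ => ?_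
  rw [prodPdf_eq_mul_erase _ _ j, Function.update_self, mul_right_comm]
  congr 2
  refine Finset.prod_congr rfl fun i hi => ?_
  rw [Function.update_of_ne (Finset.ne_of_mem_erase hi),
    Function.update_of_ne (Finset.ne_of_mem_erase hi)]

/-- Raising the mean of coordinate `j` by `ε` amounts to adding an independent Poisson variable
of mean `ε` to that coordinate. -/
lemma tsum_prodPdf_update_add {n : ℕ} {m : Fin n → ℝ} (hm : ∀ i, 0 ≤ m i) (j : Fin n)
    {ε : ℝ} (hε : 0 ≤ ε) (f : (Fin n → ℕ) → ENNReal) :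
    ∑' y, ENNReal.ofReal (prodPdf (Function.update m j (m j + ε)) y) * f y =
      ∑' e, ∑' y, ENNReal.ofReal (prodPdf m y * poissonPdf ε e) *
        f (Function.update y j (y j + e)) := by
  let G (e : ℕ) (y : Fin n → ℕ) : ENNReal := if e ≤ y j then
    ENNReal.ofReal (prodPdf m (Function.update y j (y j - e)) * poissonPdf ε e) * f y else 0
  have hG (y : Fin n → ℕ) :
      ENNReal.ofReal (prodPdf (Function.update m j (m j + ε)) y) * f y = ∑' e, G e y := by
    rw [prodPdf_update_add, ENNReal.ofReal_sum_of_nonneg fun e _ =>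
      mul_nonneg (prodPdf_nonneg hm _) (poissonPdf_nonneg hε e), Finset.sum_mul,
      tsum_eq_sum (s := Finset.range (y j + 1))]
    · refine Finset.sum_congr rfl fun e he => ?_
      exact (if_pos (Nat.lt_succ_iff.mp (Finset.mem_range.mp he))).symm
    · intro e he
      exact if_neg fun h => he (Finset.mem_range.mpr (Nat.lt_succ_iff.mpr h))
  rw [tsum_congr hG, ENNReal.tsum_comm]
  refine tsum_congr fun e => ?_
  have hinj : Function.Injective fun y : Fin n → ℕ => Function.update y j (y j + e) := by
    intro y z hyz
    funext i
    have hi := congrFun hyz i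
    by_cases hij : i = j
    · subst hij
      simpa using hi
    · simpa [hij] using hi
  rw [← hinj.tsum_eq]
  · refine tsum_congr fun y => ?_
    simp [G]
  · intro y hy
    have hey : e ≤ y j := by
      by_contra h
      exact hy (if_neg h)
    exact ⟨Function.update y j (y j - e), by simp [hey]⟩

/-- The likelihood comparison after `e` additional counts in coordinate `j`. -/
lemma prodPdf_update_le_iff {n : ℕ} (p q : Fin n → ℝ) (y : Fin n → ℕ) (j : Fin n) (e : ℕ) :
    prodPdf q (Function.update y j (y j + e)) ≤ prodPdf p (Function.update y j (y j + e)) ↔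
      prodPdf q y * q j ^ e ≤ prodPdf p y * p j ^ e := by
  have key (m : Fin n → ℝ) : prodPdf m (Function.update y j (y j + e)) =
      prodPdf m y * m j ^ e * ((Nat.factorial (y j) : ℝ) / Nat.factorial (y j + e)) := by
    have herase : ∏ i ∈ Finset.univ.erase j,
        poissonPdf (m i) (Function.update y j (y j + e) i) =
        ∏ i ∈ Finset.univ.erase j, poissonPdf (m i) (y i) :=
      Finset.prod_congr rfl fun i hi => by
        rw [Function.update_of_ne (Finset.ne_of_mem_erase hi)]
    rw [prodPdf_eq_mul_erase _ _ j, prodPdf_eq_mul_erase m y j, herase, Function.update_self]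
    unfold poissonPdf
    field_simp
    ring
  rw [key, key]
  exact mul_le_mul_iff_left₀ (by positivity)

/-- If the likelihood ratio is at least as sensitive to coordinate `j` as to coordinate `k`, then
extra counts in `j` favour the first hypothesis at least as much as extra counts in `k`. -/
lemma prodPdf_update_le_of_ratio_le {n : ℕ} {p q : Fin n → ℝ} (hp : ∀ i, 0 < p i)
    (hq : ∀ i, 0 < q i) {j k : Fin n} (hjk : p k * q j ≤ p j * q k) (y : Fin n → ℕ) (e : ℕ)
    (h : prodPdf q (Function.update y k (y k + e)) ≤
      prodPdf p (Function.update y k (y k + e))) :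
    prodPdf q (Function.update y j (y j + e)) ≤
      prodPdf p (Function.update y j (y j + e)) := by
  rw [prodPdf_update_le_iff] at h ⊢
  have hpow : p k ^ e * q j ^ e ≤ p j ^ e * q k ^ e := by
    rw [← mul_pow, ← mul_pow]
    exact pow_le_pow_left₀ (mul_nonneg (hp k).le (hq j).le) hjk e
  refine le_of_mul_le_mul_right ?_ (pow_pos (hq k) e)
  calc prodPdf q y * q j ^ e * q k ^ e = prodPdf q y * q k ^ e * q j ^ e := by ring
    _ ≤ prodPdf p y * p k ^ e * q j ^ e :=
        mul_le_mul_of_nonneg_right h (pow_pos (hq j) e).le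
    _ = prodPdf p y * (p k ^ e * q j ^ e) := by ring
    _ ≤ prodPdf p y * (p j ^ e * q k ^ e) :=
        mul_le_mul_of_nonneg_left hpow (prodPdf_nonneg (fun i => (hp i).le) y)
    _ = prodPdf p y * p j ^ e * q k ^ e := by ring

lemma summable_ite_prodPdf {n : ℕ} {m : Fin n → ℝ} (hm : ∀ i, 0 ≤ m i)
    (P : (Fin n → ℕ) → Prop) [DecidablePred P] :
    Summable fun y => if P y then prodPdf m y else 0 := by
  refine (summable_prodPdf hm).of_nonneg_of_le (fun y => ?_) fun y => ?_
  · split_ifs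
    exacts [prodPdf_nonneg hm y, le_rfl]
  · split_ifs
    exacts [le_rfl, prodPdf_nonneg hm y]

lemma errProb_nonneg {n : ℕ} {d : ℝ} {lam mu : Fin n → ℝ} (hlam : ∀ i, 0 ≤ lam i + d)
    (hmu : ∀ i, 0 ≤ mu i + d) (g : (Fin n → ℕ) → Bool) : 0 ≤ errProb d lam mu g := by
  refine add_nonneg (mul_nonneg (by norm_num) (tsum_nonneg fun y => ?_))
    (mul_nonneg (by norm_num) (tsum_nonneg fun y => ?_))
  · split_ifs
    exacts [prodPdf_nonneg hlam y, le_rfl]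
  · split_ifs
    exacts [prodPdf_nonneg hmu y, le_rfl]

open Classical in
/-- The maximum-likelihood decoder. -/
noncomputable def mlDecoder {n : ℕ} (d : ℝ) (lam mu : Fin n → ℝ) (y : Fin n → ℕ) : Bool :=
  decide (prodPdf (fun i => mu i + d) y ≤ prodPdf (fun i => lam i + d) y)

lemma errProb_mlDecoder_le {n : ℕ} {d : ℝ} {lam mu : Fin n → ℝ} (hlam : ∀ i, 0 ≤ lam i + d)
    (hmu : ∀ i, 0 ≤ mu i + d) (g : (Fin n → ℕ) → Bool) :
    errProb d lam mu (mlDecoder d lam mu) ≤ errProb d lam mu g := by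
  unfold errProb
  rw [← mul_add, ← mul_add,
    ← (summable_ite_prodPdf hlam _).tsum_add (summable_ite_prodPdf hmu _),
    ← (summable_ite_prodPdf hlam _).tsum_add (summable_ite_prodPdf hmu _)]
  refine mul_le_mul_of_nonneg_left ?_ (by norm_num)
  refine ((summable_ite_prodPdf hlam _).add (summable_ite_prodPdf hmu _)).tsum_le_tsum
    (fun y => ?_) ((summable_ite_prodPdf hlam _).add (summable_ite_prodPdf hmu _))
  by_cases h : prodPdf (fun i => mu i + d) y ≤ prodPdf (fun i => lam i + d) y
  · cases hg : g y <;> simp [mlDecoder, h]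
  · cases hg : g y <;> simp [mlDecoder, h, (not_le.mp h).le]

lemma Pe_le_errProb {n : ℕ} {d : ℝ} {lam mu : Fin n → ℝ} (hlam : ∀ i, 0 ≤ lam i + d)
    (hmu : ∀ i, 0 ≤ mu i + d) (g : (Fin n → ℕ) → Bool) : Pe d lam mu ≤ errProb d lam mu g :=
  ciInf_le ⟨0, by rintro _ ⟨g, rfl⟩; exact errProb_nonneg hlam hmu g⟩ g

lemma Pe_eq_errProb_mlDecoder {n : ℕ} {d : ℝ} {lam mu : Fin n → ℝ}
    (hlam : ∀ i, 0 ≤ lam i + d) (hmu : ∀ i, 0 ≤ mu i + d) :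
    Pe d lam mu = errProb d lam mu (mlDecoder d lam mu) :=
  le_antisymm (Pe_le_errProb hlam hmu _) (le_ciInf (errProb_mlDecoder_le hlam hmu))

/-- An event that is less likely to be reached by extra counts in coordinate `j` than in
coordinate `k` loses probability when mass `ε` is added to `j` instead of `k`. -/
lemma tsum_ite_prodPdf_update_le {n : ℕ} {m : Fin n → ℝ} (hm : ∀ i, 0 ≤ m i) (j k : Fin n)
    {ε : ℝ} (hε : 0 ≤ ε) (P : (Fin n → ℕ) → Prop) [DecidablePred P]
    (hP : ∀ y e, P (Function.update y j (y j + e)) → P (Function.update y k (y k + e))) :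
    (∑' y, if P y then prodPdf (Function.update m j (m j + ε)) y else 0) ≤
      ∑' y, if P y then prodPdf (Function.update m k (m k + ε)) y else 0 := by
  have hm' (l i : Fin n) : 0 ≤ Function.update m l (m l + ε) i := by
    rcases eq_or_ne i l with rfl | h
    · simpa using add_nonneg (hm i) hε
    · simpa [h] using hm i
  have hnonneg (l : Fin n) (y : Fin n → ℕ) :
      0 ≤ if P y then prodPdf (Function.update m l (m l + ε)) y else 0 := by
    split_ifs
    exacts [prodPdf_nonneg (hm' l) y, le_rfl]
  have hofReal (l : Fin n) :
      ENNReal.ofReal (∑' y, if P y then prodPdf (Function.update m l (m l + ε)) y else 0) =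
      ∑' e, ∑' y, ENNReal.ofReal (prodPdf m y * poissonPdf ε e) *
        if P (Function.update y l (y l + e)) then 1 else 0 := by
    rw [ENNReal.ofReal_tsum_of_nonneg (hnonneg l) (summable_ite_prodPdf (hm' l) P),
      ← tsum_prodPdf_update_add hm l hε fun y => if P y then 1 else 0]
    refine tsum_congr fun y => ?_
    split_ifs <;> simp
  rw [← ENNReal.ofReal_le_ofReal_iff (tsum_nonneg (hnonneg k)), hofReal, hofReal]
  refine ENNReal.tsum_le_tsum fun e => ENNReal.tsum_le_tsum fun y => ?_
  gcongr
  by_cases h : P (Function.update y j (y j + e))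
  · simp [h, hP y e h]
  · simp [h]

/-- Moving mass `ε` from coordinate `k` to coordinate `j` of `λ` when
`a_j = log((λ_j+d)/(μ_j+d)) ≥ a_k = log((λ_k+d)/(μ_k+d))` does not increase the
ML error probability. -/
theorem stmt8 (n : ℕ) (hn : 1 ≤ n) (d : ℝ) (hd : 0 < d)
    (lam mu : Fin n → ℝ) (hlam : ∀ i, 0 ≤ lam i) (hmu : ∀ i, 0 ≤ mu i)
    (a : Fin n → ℝ) (ha : ∀ i, a i = Real.log ((lam i + d) / (mu i + d)))
    (j k : Fin n) (hjk : j ≠ k) (hajk : a k ≤ a j)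
    (ε : ℝ) (hε0 : 0 ≤ ε) (hεk : ε ≤ lam k)
    (lam' : Fin n → ℝ)
    (hl' : ∀ i, lam' i = if i = j then lam j + ε else if i = k then lam k - ε else lam i) :
    Pe d lam' mu ≤ Pe d lam mu := by
  have hp (i) : 0 < lam i + d := add_pos_of_nonneg_of_pos (hlam i) hd
  have hq (i) : 0 < mu i + d := add_pos_of_nonneg_of_pos (hmu i) hd
  have hp' (i) : 0 ≤ lam' i + d := by
    rw [hl']
    split_ifs
    · linarith [hp j]
    · linarith
    · exact (hp i).le
  have hratio : (lam k + d) * (mu j + d) ≤ (lam j + d) * (mu k + d) := by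
    rw [ha, ha, Real.log_le_log_iff (div_pos (hp k) (hq k)) (div_pos (hp j) (hq j)),
      div_le_div_iff₀ (hq k) (hq j)] at hajk
    exact hajk
  rw [Pe_eq_errProb_mlDecoder (fun i => (hp i).le) fun i => (hq i).le]
  refine (Pe_le_errProb hp' (fun i => (hq i).le) (mlDecoder d lam mu)).trans ?_
  unfold errProb
  gcongr ?_ + _
  refine mul_le_mul_of_nonneg_left ?_ (by norm_num)
  let m : Fin n → ℝ := Function.update (fun i => lam i + d) k (lam k - ε + d)
  have hm (i) : 0 ≤ m i := by
    rcases eq_or_ne i k with rfl | h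
    · simp only [m, Function.update_self]
      linarith
    · simpa [m, h] using (hp i).le
  have hmj : Function.update m j (m j + ε) = fun i => lam' i + d := by
    funext i
    rw [hl']
    rcases eq_or_ne i j with rfl | hij
    · simp only [m, Function.update_self, Function.update_of_ne hjk, if_true]
      ring
    · rcases eq_or_ne i k with rfl | hik <;> simp [m, *]
  have hmk : Function.update m k (m k + ε) = fun i => lam i + d := by
    funext i
    rcases eq_or_ne i k with rfl | hik
    · simp only [m, Function.update_self]
      ring
    · simp [m, hik]
  have h := tsum_ite_prodPdf_update_le hm j k hε0 (fun y => mlDecoder d lam mu y = false)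
    fun y e hy => by
      simp only [mlDecoder, decide_eq_false_iff_not] at hy ⊢
      exact fun hk => hy (prodPdf_update_le_of_ratio_le hp hq hratio y e hk)
  rwa [hmj, hmk] at h
end

section
/- Let λ, π ∈ [0,∞)^N be nonincreasing sequences (λ_0 ≥ λ_1 ≥ … ≥ λ_{N−1} and π_0 ≥ π_1 ≥ … ≥ π_{N−1}) such that λ is weakly submajorized by π. Then there exists t ∈ {0, …, N−1} such that, setting r := ∑_{i=0}^{N−1} λ_i − ∑_{j=0}^{t−1} π_j, one has 0 ≤ r ≤ π_t, and λ is majorized by the vector π' := (π_0, …, π_{t−1}, r, 0, …, 0) ∈ [0,∞)^N: for every k ∈ {1, …, N} the sum of the first k entries of λ is at most the sum of the first k entries of π', with equality for k = N. -/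
open scoped BigOperators

/-- The sum of the first `k` entries of `v`. -/
noncomputable def prefixSum {m : ℕ} (v : Fin m → ℝ) (k : ℕ) : ℝ :=
  ∑ i ∈ Finset.univ.filter (fun i : Fin m => (i : ℕ) < k), v i

lemma prefixSum_zero {m : ℕ} (v : Fin m → ℝ) : prefixSum v 0 = 0 := by
  simp [prefixSum]

lemma prefixSum_self {m : ℕ} (v : Fin m → ℝ) : prefixSum v m = ∑ i, v i := by
  simp [prefixSum]

lemma prefixSum_succ {m : ℕ} (v : Fin m → ℝ) (t : Fin m) :
    prefixSum v (t + 1) = prefixSum v t + v t := by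
  have h : Finset.univ.filter (fun i : Fin m => (i : ℕ) < t + 1) =
      insert t (Finset.univ.filter (fun i : Fin m => (i : ℕ) < t)) := by
    ext i
    simp only [Finset.mem_filter, Finset.mem_univ, true_and, Finset.mem_insert, Fin.ext_iff]
    omega
  rw [prefixSum, h, Finset.sum_insert (by simp), add_comm, prefixSum]

lemma prefixSum_congr {m : ℕ} {u v : Fin m → ℝ} {k : ℕ}
    (h : ∀ i : Fin m, (i : ℕ) < k → u i = v i) : prefixSum u k = prefixSum v k :=
  Finset.sum_congr rfl fun i hi => h i (Finset.mem_filter.1 hi).2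

lemma card_filter_val_lt {m k : ℕ} (hk : k ≤ m) :
    (Finset.univ.filter (fun i : Fin m => (i : ℕ) < k)).card = k := by
  rw [Fin.card_filter_val_lt, min_eq_right hk]

lemma prefixSum_le_topSum {m k : ℕ} (v : Fin m → ℝ) (hk : k ≤ m) :
    prefixSum v k ≤ topSum v k := by
  have h := le_ciSup (f := fun s : Finset (Fin m) =>
    ⨆ _ : s ∈ {s : Finset (Fin m) | s.card = k}, ∑ i ∈ s, v i) (Set.finite_range _).bddAbove
    (Finset.univ.filter (fun i : Fin m => (i : ℕ) < k))
  have hmem : Finset.univ.filter (fun i : Fin m => (i : ℕ) < k) ∈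
      {s : Finset (Fin m) | s.card = k} := card_filter_val_lt hk
  rwa [ciSup_pos hmem] at h

lemma sum_le_prefixSum {m : ℕ} {v : Fin m → ℝ} (hv : Antitone v) (s : Finset (Fin m)) :
    ∑ i ∈ s, v i ≤ prefixSum v s.card := by
  have hs : s.card ≤ m := by simpa using s.card_le_univ
  rcases Nat.eq_zero_or_pos s.card with h0 | hpos
  · simp [Finset.card_eq_zero.1 h0, prefixSum]
  set F := Finset.univ.filter (fun i : Fin m => (i : ℕ) < s.card) with hF
  have hcard : (s \ F).card = (F \ s).card :=
    Finset.card_sdiff_comm (card_filter_val_lt hs).symm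
  let c : Fin m := ⟨s.card - 1, by omega⟩
  refine Finset.sum_sdiff_le_sum_sdiff.1 ?_
  calc ∑ i ∈ s \ F, v i ≤ (s \ F).card • v c := by
        refine Finset.sum_le_card_nsmul _ _ _ fun i hi => hv ?_
        have : ¬ (i : ℕ) < s.card := by simpa [hF] using (Finset.mem_sdiff.1 hi).2
        exact Fin.le_def.2 (by simp only [c]; omega)
    _ = (F \ s).card • v c := by rw [hcard]
    _ ≤ ∑ i ∈ F \ s, v i := by
        refine Finset.card_nsmul_le_sum _ _ _ fun i hi => hv ?_
        have : (i : ℕ) < s.card := by simpa [hF] using (Finset.mem_sdiff.1 hi).1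
        exact Fin.le_def.2 (by simp only [c]; omega)

lemma prefixSum_nonneg {m : ℕ} {v : Fin m → ℝ} (h0 : ∀ i, 0 ≤ v i) (k : ℕ) :
    0 ≤ prefixSum v k :=
  Finset.sum_nonneg fun i _ => h0 i

lemma prefixSum_le_sum {m : ℕ} {v : Fin m → ℝ} (h0 : ∀ i, 0 ≤ v i) (k : ℕ) :
    prefixSum v k ≤ ∑ i, v i :=
  Finset.sum_le_sum_of_subset_of_nonneg (Finset.filter_subset _ _) fun i _ _ => h0 i

lemma topSum_le_prefixSum {m : ℕ} {v : Fin m → ℝ} (h0 : ∀ i, 0 ≤ v i) (hv : Antitone v)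
    (k : ℕ) : topSum v k ≤ prefixSum v k := by
  refine Real.iSup_le (fun s => Real.iSup_le (fun hs => ?_) (prefixSum_nonneg h0 k))
    (prefixSum_nonneg h0 k)
  rw [← show s.card = k from hs]
  exact sum_le_prefixSum hv s

/-- If the nonincreasing nonnegative sequence `λ` is weakly submajorized by the
nonincreasing nonnegative sequence `π`, then `λ` is majorized by
`π' = (π₀, …, π_{t−1}, r, 0, …, 0)` for some `t`, where
`r = ∑ λ − ∑_{j<t} π_j ∈ [0, π_t]`. -/
theorem stmt10 (N : ℕ) (hN : 1 ≤ N) (lam p : Fin N → ℝ)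
    (hlam0 : ∀ i, 0 ≤ lam i) (hp0 : ∀ i, 0 ≤ p i)
    (hlamdec : ∀ i j : Fin N, i ≤ j → lam j ≤ lam i)
    (hpdec : ∀ i j : Fin N, i ≤ j → p j ≤ p i)
    (hmaj : ∀ k, 1 ≤ k → k ≤ N → topSum lam k ≤ topSum p k) :
    ∃ t : Fin N, ∃ p' : Fin N → ℝ,
      (∀ i : Fin N, p' i =
        if (i : ℕ) < (t : ℕ) then p i
        else if (i : ℕ) = (t : ℕ) then
          (∑ i, lam i) - ∑ j ∈ Finset.univ.filter (fun j : Fin N => (j : ℕ) < (t : ℕ)), p j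
        else 0) ∧
      0 ≤ (∑ i, lam i)
            - (∑ j ∈ Finset.univ.filter (fun j : Fin N => (j : ℕ) < (t : ℕ)), p j) ∧
      (∑ i, lam i)
            - (∑ j ∈ Finset.univ.filter (fun j : Fin N => (j : ℕ) < (t : ℕ)), p j) ≤ p t ∧
      (∀ k, 1 ≤ k → k ≤ N →
        (∑ i ∈ Finset.univ.filter (fun i : Fin N => (i : ℕ) < k), lam i)
          ≤ ∑ i ∈ Finset.univ.filter (fun i : Fin N => (i : ℕ) < k), p' i) ∧
      (∑ i, lam i) = ∑ i, p' i := by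
  have hle : ∀ k, 1 ≤ k → k ≤ N → prefixSum lam k ≤ prefixSum p k := fun k h1 hk =>
    (prefixSum_le_topSum lam hk).trans ((hmaj k h1 hk).trans
      (topSum_le_prefixSum hp0 (fun i j h => hpdec i j h) k))
  classical
  have hex : ∃ t, ∑ i, lam i ≤ prefixSum p (t + 1) := by
    refine ⟨N - 1, ?_⟩
    rw [Nat.sub_add_cancel hN, ← prefixSum_self]
    exact hle N hN le_rfl
  obtain ⟨t, ht, htN, hmin⟩ : ∃ t, ∑ i, lam i ≤ prefixSum p (t + 1) ∧ t < N ∧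
      prefixSum p t ≤ ∑ i, lam i := by
    refine ⟨Nat.find hex, Nat.find_spec hex, ?_, ?_⟩
    · refine lt_of_le_of_lt (Nat.find_min' hex (m := N - 1) ?_) (Nat.sub_lt hN one_pos)
      rw [Nat.sub_add_cancel hN, ← prefixSum_self]
      exact hle N hN le_rfl
    · rcases h : Nat.find hex with _ | n
      · rw [prefixSum_zero]
        exact Finset.sum_nonneg fun i _ => hlam0 i
      · exact (not_le.1 (Nat.find_min hex (m := n) (by omega))).le
  let t' : Fin N := ⟨t, htN⟩
  let p' : Fin N → ℝ := fun i =>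
    if (i : ℕ) < t then p i else if (i : ℕ) = t then ∑ i, lam i - prefixSum p t else 0
  have hinit : ∀ k ≤ t, prefixSum p' k = prefixSum p k := fun k hk =>
    prefixSum_congr fun i hi => if_pos (hi.trans_le hk)
  have htail : ∀ k, t + 1 ≤ k → k ≤ N → prefixSum p' k = ∑ i, lam i := by
    intro k hk
    induction k, hk using Nat.le_induction with
    | base =>
      intro _
      have h := prefixSum_succ p' t'
      simp only [t', hinit t le_rfl] at h
      rw [h]
      simp [p']
    | succ k hk ih =>
      intro hkN
      have h := prefixSum_succ p' ⟨k, hkN⟩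
      have hz : p' ⟨k, hkN⟩ = 0 := by
        simp only [p']
        rw [if_neg (by omega), if_neg (by omega)]
      rw [h, hz, add_zero, ih (by omega)]
  have hsucc := prefixSum_succ p t'
  refine ⟨t', p', fun i => rfl, sub_nonneg.2 hmin, ?_, fun k h1 hk => ?_, ?_⟩
  · exact sub_le_iff_le_add'.2 (ht.trans_eq hsucc)
  · change prefixSum lam k ≤ prefixSum p' k
    rcases le_or_gt k t with hkt | hkt
    · rw [hinit k hkt]
      exact hle k h1 hk
    · rw [htail k hkt hk]
      exact prefixSum_le_sum hlam0 k
  · rw [← prefixSum_self p', htail N htN le_rfl]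
end
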